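/- For the smooth Hesse cubic F_λ with λ³ ≠ 1, the j-invariant of the curve F_λ = 0 equals 1728·λ³(λ³+8)³ / (64(λ³−1)³). -/

import Mathlib

open MvPolynomial

noncomputable section

/-- `F(g·x)`: the substitution of a linear change of variables `g` into `F`. -/
def applyMat (g : Matrix (Fin 3) (Fin 3) ℂ) (F : MvPolynomial (Fin 3) ℂ) :
    MvPolynomial (Fin 3) ℂ :=
  aeval (fun i => ∑ j, C (g i j) * X j) F

/-- The Hesse cubic `x₀³ + x₁³ + x₂³ - 3λx₀x₁x₂`. -/
def hesseCubic (l : ℂ) : MvPolynomial (Fin 3) ℂ :=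
  X 0 ^ 3 + X 1 ^ 3 + X 2 ^ 3 - C (3 * l) * (X 0 * X 1 * X 2)

/-- The homogeneous Weierstrass cubic
`Y²Z + a₁XYZ + a₃YZ² - X³ - a₂X²Z - a₄XZ² - a₆Z³` (with `X,Y,Z` indexed by `0,1,2`). -/
def wPoly (E : WeierstrassCurve ℂ) : MvPolynomial (Fin 3) ℂ :=
  X 1 ^ 2 * X 2 + C E.a₁ * (X 0 * X 1 * X 2) + C E.a₃ * (X 1 * X 2 ^ 2)
    - (X 0 ^ 3 + C E.a₂ * (X 0 ^ 2 * X 2) + C E.a₄ * (X 0 * X 2 ^ 2) + C E.a₆ * X 2 ^ 3)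

/-- The smooth plane cubic `F = 0` has j-invariant `j₀`: `F` is linearly equivalent to the
homogeneous Weierstrass cubic of an elliptic curve with j-invariant `j₀`. -/
def HasJInvariant (F : MvPolynomial (Fin 3) ℂ) (j₀ : ℂ) : Prop :=
  ∃ (E : WeierstrassCurve ℂ) (hE : E.IsElliptic),
    @WeierstrassCurve.j ℂ _ E hE = j₀ ∧
      ∃ g : Matrix (Fin 3) (Fin 3) ℂ, IsUnit g.det ∧ applyMat g F = wPoly E

/-- For the smooth Hesse cubic (`λ³ ≠ 1`), the j-invariant of the curve
`F_λ = 0` equals `1728·λ³(λ³+8)³ / (64(λ³-1)³)`. -/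
theorem stmt_14 (l : ℂ) (hl : l ^ 3 ≠ 1) :
    HasJInvariant (hesseCubic l)
      (1728 * (l ^ 3 * (l ^ 3 + 8) ^ 3) / (64 * (l ^ 3 - 1) ^ 3)) := by
  have hd : l ^ 3 - 1 ≠ 0 := sub_ne_zero.mpr hl
  obtain ⟨a, ha⟩ := IsAlgClosed.exists_pow_nat_eq ((l ^ 3 - 1)⁻¹) (n := 3) (by norm_num)
  have ha0 : a ≠ 0 := by
    rintro rfl
    have := inv_ne_zero hd
    apply this
    rw [← ha]
    norm_num
  have had : a ^ 3 * (l ^ 3 - 1) = 1 := by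
    rw [ha]
    exact inv_mul_cancel₀ hd
  let E : WeierstrassCurve ℂ := ⟨0, -(3 / 4) * l ^ 2 * a ^ 2, 0, l * a / 6, -1 / 108⟩
  have hΔ : E.Δ = a ^ 3 / 27 := by
    simp only [E, WeierstrassCurve.Δ, WeierstrassCurve.b₂, WeierstrassCurve.b₄,
      WeierstrassCurve.b₆, WeierstrassCurve.b₈]
    linear_combination (1 / 27) * had
  have hc : E.c₄ = l * a * (9 * (l * a) ^ 3 - 8) := by
    simp only [E, WeierstrassCurve.c₄, WeierstrassCurve.b₂, WeierstrassCurve.b₄]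
    ring
  have hc' : E.c₄ = l * a * (a ^ 3 * (l ^ 3 + 8)) := by
    rw [hc]
    linear_combination 8 * l * a * had
  have hE : E.IsElliptic := ⟨by
    rw [hΔ, isUnit_iff_ne_zero]
    exact div_ne_zero (pow_ne_zero 3 ha0) (by norm_num)⟩
  refine ⟨E, hE, ?_, !![-l * a / 2, 1, 1 / 6; -l * a / 2, -1, 1 / 6; a, 0, 0], ?_, ?_⟩
  · rw [WeierstrassCurve.j, Units.val_inv_eq_inv_val, WeierstrassCurve.coe_Δ', hΔ, hc']
    have h3 : (l * a * (a ^ 3 * (l ^ 3 + 8))) ^ 3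
        = a ^ 3 * (a ^ 3) ^ 3 * (l ^ 3 * (l ^ 3 + 8) ^ 3) := by ring
    rw [h3, ha]
    field_simp
    ring
  · rw [isUnit_iff_ne_zero, Matrix.det_fin_three]
    simp
    intro h
    apply ha0
    exact h
  · apply MvPolynomial.funext
    intro x
    simp [applyMat, hesseCubic, wPoly, E, Fin.sum_univ_three]
    linear_combination (-(x 0) ^ 3) * had

end
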